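/- Let N, d be positive integers, let λ > 0 and τ ∈ (0,1] be real numbers, and let C = [c_uv] be a symmetric N×N real matrix whose rows sum to one (Σ_{v=1}^N c_uv = 1 for every u). Fix Y = (y_1,…,y_N) ∈ (ℝ^d)^N and let E be the associated denoising objective. Then the point Z' ∈ (ℝ^d)^N obtained by one gradient-descent step of step size τ/(4λ) at the point Y, i.e. Z' = Y − (τ/(4λ)) ∇E(Y), satisfies componentwise z'_u = (1 − τ) y_u + τ Σ_{v=1}^N c_uv y_v for every u = 1,…,N. In other words, the attention-layer update rule z_u^{(k)} = (1−τ) z_u^{(k−1)} + τ Σ_v c_uv z_v^{(k−1)} coincides with a gradient-descent step on the denoising objective taken at Z^{(k−1)}. -/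

import Mathlib

/-- For symmetric weights with rows summing to one, the graph Dirichlet form is twice the quadratic
form of the Laplacian `1 - C`. -/
lemma sum_mul_sub_mul_sub_of_isSymm {ι : Type*} [Fintype ι] {C : Matrix ι ι ℝ}
    (hC : C.IsSymm) (hrow : ∀ u, ∑ v, C u v = 1) (y h : ι → ℝ) :
    ∑ a, ∑ b, C a b * ((y a - y b) * (h a - h b)) =
      2 * ∑ a, (y a - ∑ b, C a b * y b) * h a := by
  have key : ∀ a, ∑ b, C a b * (y a - y b) = y a - ∑ b, C a b * y b := fun a => by
    simp only [mul_sub, Finset.sum_sub_distrib, ← Finset.sum_mul, hrow, one_mul]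
  have hswap : ∑ a, ∑ b, C a b * (y a - y b) * h b =
      -∑ a, ∑ b, C a b * (y a - y b) * h a := by
    rw [Finset.sum_comm]
    simp only [← Finset.sum_neg_distrib]
    refine Finset.sum_congr rfl fun a _ => Finset.sum_congr rfl fun b _ => ?_
    rw [hC.apply a b]
    ring
  calc ∑ a, ∑ b, C a b * ((y a - y b) * (h a - h b))
      = ∑ a, ∑ b, C a b * (y a - y b) * h a - ∑ a, ∑ b, C a b * (y a - y b) * h b := by
        simp only [← Finset.sum_sub_distrib]
        refine Finset.sum_congr rfl fun a _ => Finset.sum_congr rfl fun b _ => ?_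
        ring
    _ = 2 * ∑ a, (y a - ∑ b, C a b * y b) * h a := by
        rw [hswap]
        simp only [← Finset.sum_mul, key]
        ring

/-- The gradient of the graph signal denoising objective at its own target is `4λ (1 - C) Y`. -/
lemma hasGradientAt_graphDenoising {ι κ : Type*} [Fintype ι] [Fintype κ] {C : Matrix ι ι ℝ}
    (hC : C.IsSymm) (hrow : ∀ u, ∑ v, C u v = 1) (lam : ℝ) (Y : EuclideanSpace ℝ (ι × κ)) :
    HasGradientAt (fun W : EuclideanSpace ℝ (ι × κ) =>
        (∑ a, ∑ j, (W (a, j) - Y (a, j)) ^ 2)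
          + lam * ∑ a, ∑ b, C a b * ∑ j, (W (a, j) - W (b, j)) ^ 2)
      (WithLp.toLp 2 fun p => 4 * lam * (Y p - ∑ v, C p.1 v * Y (v, p.2))) Y := by
  have hcoord (p : ι × κ) : HasFDerivAt (fun W : EuclideanSpace ℝ (ι × κ) => W p)
      (EuclideanSpace.proj p : EuclideanSpace ℝ (ι × κ) →L[ℝ] ℝ) Y :=
    (EuclideanSpace.proj p : EuclideanSpace ℝ (ι × κ) →L[ℝ] ℝ).hasFDerivAt
  have hderiv := (HasFDerivAt.fun_sum (u := Finset.univ) fun a _ =>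
      HasFDerivAt.fun_sum (u := Finset.univ) fun j _ =>
        ((hcoord (a, j)).sub_const (Y (a, j))).pow 2).add
    ((HasFDerivAt.fun_sum (u := Finset.univ) fun a _ =>
      HasFDerivAt.fun_sum (u := Finset.univ) fun b _ =>
        (HasFDerivAt.fun_sum (u := Finset.univ) fun j _ =>
          ((hcoord (a, j)).sub (hcoord (b, j))).pow 2).const_mul (C a b)).const_mul lam)
  rw [hasGradientAt_iff_hasFDerivAt]
  refine hderiv.congr_fderiv ?_
  ext h
  have hform : ∑ a, ∑ b, C a b * ∑ j, 2 * (Y (a, j) - Y (b, j)) * (h (a, j) - h (b, j)) =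
      ∑ a, ∑ j, 4 * (Y (a, j) - ∑ b, C a b * Y (b, j)) * h (a, j) := by
    calc _ = ∑ a, ∑ b, ∑ j,
          2 * (C a b * ((Y (a, j) - Y (b, j)) * (h (a, j) - h (b, j)))) := by
          simp only [Finset.mul_sum]
          refine Finset.sum_congr rfl fun a _ => Finset.sum_congr rfl fun b _ =>
            Finset.sum_congr rfl fun j _ => ?_
          ring
      _ = ∑ j, ∑ a, ∑ b,
          2 * (C a b * ((Y (a, j) - Y (b, j)) * (h (a, j) - h (b, j)))) :=
          (Finset.sum_congr rfl fun _ _ => Finset.sum_comm).trans Finset.sum_comm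
      _ = ∑ j, ∑ a, 4 * (Y (a, j) - ∑ b, C a b * Y (b, j)) * h (a, j) := by
          refine Finset.sum_congr rfl fun j _ => ?_
          simp only [← Finset.mul_sum, mul_assoc]
          rw [sum_mul_sub_mul_sub_of_isSymm hC hrow (fun a => Y (a, j)) (fun a => h (a, j))]
          ring
      _ = _ := Finset.sum_comm
  trans lam * ∑ a, ∑ b, C a b * ∑ j, 2 * (Y (a, j) - Y (b, j)) * (h (a, j) - h (b, j))
  · simp
  · rw [hform]
    simp only [InnerProductSpace.toDual_apply_apply, PiLp.inner_apply, Fintype.sum_prod_type,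
      Finset.mul_sum, RCLike.inner_apply, conj_trivial]
    refine Finset.sum_congr rfl fun a _ => Finset.sum_congr rfl fun j _ => ?_
    ring

/-- One gradient-descent step of step size `τ/(4λ)` on the graph signal
denoising objective `E(Z) = Σ_u ‖z_u − y_u‖₂² + λ Σ_{u,v} c_uv ‖z_u − z_v‖₂²`, taken at the
point `Y` itself, reproduces the attention-layer update
`z'_u = (1 − τ) y_u + τ Σ_v c_uv y_v`, provided `C` is symmetric with rows summing to one.
Points `Z ∈ (ℝ^d)^N` are modelled as elements of the Euclidean space
`EuclideanSpace ℝ (Fin N × Fin d)`, so the gradient is taken with respect to the standard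
inner product on the `N·d`-dimensional Euclidean space, and `‖x‖₂² = Σ_i x_i²`. -/
theorem sgformer_attention_update_is_gradient_step
    (N d : ℕ) (hN : 0 < N) (hd : 0 < d) (lam τ : ℝ) (hlam : 0 < lam)
    (hτ0 : 0 < τ) (hτ1 : τ ≤ 1)
    (C : Matrix (Fin N) (Fin N) ℝ) (hCsym : C.IsSymm)
    (hrow : ∀ u : Fin N, ∑ v : Fin N, C u v = 1)
    (Y : EuclideanSpace ℝ (Fin N × Fin d)) :
    ∀ (u : Fin N) (i : Fin d),
      (Y - (τ / (4 * lam)) •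
          gradient (fun W : EuclideanSpace ℝ (Fin N × Fin d) =>
            (∑ a : Fin N, ∑ j : Fin d, (W (a, j) - Y (a, j)) ^ 2)
              + lam * ∑ a : Fin N, ∑ b : Fin N,
                  C a b * ∑ j : Fin d, (W (a, j) - W (b, j)) ^ 2) Y) (u, i)
        = (1 - τ) * Y (u, i) + τ * ∑ v : Fin N, C u v * Y (v, i) := by
  intro u i
  rw [(hasGradientAt_graphDenoising hCsym hrow lam Y).gradient]
  simp only [PiLp.sub_apply, PiLp.smul_apply, smul_eq_mul]
  field_simp
  ring
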